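/- Let A be a commutative ring, I an ideal, and let B = A/I. If (A, I) is a henselian pair and A → A' is a finite ring homomorphism, then (A', IA') is a henselian pair. -/

import Mathlib

open Polynomial in
/-- If `g * h = X ^ m * q` with `g` monic of degree `m`, then `h(0) ^ m` annihilates the
coefficients of `g - X ^ m` and those of `h - q`. -/
theorem Polynomial.C_coeff_zero_pow_mul_sub_eq_zero {R : Type*} [CommRing R] {m : ℕ} {g h q : R[X]}
    (hg : ∀ i, m ≤ i → g.coeff i = (X ^ m : R[X]).coeff i) (hgh : g * h = X ^ m * q) :
    C (h.coeff 0 ^ m) * (g - X ^ m) = 0 ∧ C (h.coeff 0 ^ m) * (h - q) = 0 := by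
  have hX : (X : R[X]) ∣ C (h.coeff 0) - h := by
    rw [X_dvd_iff]; simp
  have h1 : X ^ m ∣ (C (h.coeff 0) - h) ^ m := pow_dvd_pow_of_dvd hX m
  obtain ⟨r, hr⟩ : h ∣ C (h.coeff 0) ^ m - (C (h.coeff 0) - h) ^ m := by
    refine dvd_trans ?_ (sub_dvd_pow_sub_pow _ _ m)
    simp
  have key : C (h.coeff 0 ^ m) * (g - X ^ m) = 0 := by
    have hd : X ^ m ∣ C (h.coeff 0 ^ m) * (g - X ^ m) := by
      have : C (h.coeff 0 ^ m) * (g - X ^ m) =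
          (C (h.coeff 0) - h) ^ m * (g - X ^ m) + X ^ m * (q * r - h * r) := by
        rw [C_pow]
        linear_combination (g - X ^ m) * hr + r * hgh
      rw [this]
      exact dvd_add (h1.mul_right _) (dvd_mul_right _ _)
    ext i
    rcases lt_or_ge i m with hi | hi
    · simpa using X_pow_dvd_iff.mp hd i hi
    · rw [coeff_C_mul, coeff_sub, hg i hi]; simp
  refine ⟨key, ?_⟩
  have : X ^ m * (C (h.coeff 0 ^ m) * (h - q)) = X ^ m * 0 := by
    linear_combination C (h.coeff 0 ^ m) * hgh - h * key
  exact (monic_X_pow m).isRegular.left this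

open Polynomial in
/-- Let `b` be an element of a finite algebra whose image modulo `I` is the idempotent cutting out
the quotient `A ⧸ I`. Then `b` is annihilated by a monic polynomial lifting `X ^ n * (X - 1)`. -/
theorem exists_monic_aeval_eq_zero_of_algHom_quotient {A U : Type*} [CommRing A] [CommRing U]
    [Algebra A U] [Module.Finite A U] (I : Ideal A) (σ : U →ₐ[A] A ⧸ I) (b : U) (hb : σ b = 1)
    (hker : ∀ x, σ x = 0 → b * x ∈ I.map (algebraMap A U)) :
    ∃ p : A[X], p.Monic ∧ aeval b p = 0 ∧
      ∃ n : ℕ, p.map (Ideal.Quotient.mk I) = X ^ n * (X - 1) := by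
  classical
  obtain ⟨n, u, hu⟩ := Module.Finite.exists_fin (R := A) (M := U)
  choose a ha using fun i ↦ Ideal.Quotient.mk_surjective (σ (u i))
  let v : Option (Fin n) → U := fun j ↦ j.elim b fun i ↦ u i - a i • b
  let d : Option (Fin n) → A := fun j ↦ j.elim 1 fun _ ↦ 0
  have hv : Submodule.span A (Set.range v) = ⊤ := by
    rw [eq_top_iff, ← hu, Submodule.span_le]
    rintro _ ⟨i, rfl⟩
    have h0 : b ∈ Submodule.span A (Set.range v) := Submodule.subset_span ⟨none, rfl⟩
    have h1 : u i - a i • b ∈ Submodule.span A (Set.range v) :=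
      Submodule.subset_span ⟨some i, rfl⟩
    simpa using add_mem h1 (Submodule.smul_mem _ (a i) h0)
  have hN (j) : b * v j - d j • v j ∈ LinearMap.range (Ideal.finsuppTotal _ U I v) := by
    rw [Ideal.range_finsuppTotal, hv, Ideal.smul_top_eq_map]
    cases j with
    | none =>
      have := hker (b - 1) (by simp [hb])
      simpa [v, d, mul_sub] using this
    | some i =>
      have := hker (u i - a i • b) (by
        rw [map_sub, map_smul, hb, ← ha, Algebra.smul_def]; simp)
      simpa [v, d] using this
  choose N hN using hN
  let M : Matrix (Option (Fin n)) (Option (Fin n)) A :=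
    Matrix.diagonal d + Matrix.of fun i j ↦ (N j i : A)
  have hM : M.Represents v (Algebra.lmul A U b) := by
    rw [Matrix.represents_iff']
    intro j
    have := hN j
    rw [Ideal.finsuppTotal_apply_eq_of_fintype] at this
    simp only [M, Matrix.add_apply, add_smul, Finset.sum_add_distrib, Matrix.of_apply, this,
      Algebra.coe_lmul_eq_mul, LinearMap.mul_apply']
    simp [Matrix.diagonal_apply, ite_smul]
  refine ⟨M.charpoly, M.charpoly_monic, ?_, n, ?_⟩
  · let M' : Matrix.isRepresentation A v := ⟨M, _, hM⟩
    have h1 := Matrix.isRepresentation.eq_toEnd_of_represents A v hv M' hM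
    have h2 : aeval M' M.charpoly = 0 := by
      ext1
      rw [aeval_subalgebra_coe]
      exact M.aeval_self_charpoly
    have h3 : aeval (Algebra.lmul A U b) M.charpoly = 0 := by
      rw [← h1, aeval_algHom_apply, h2, map_zero]
    have h4 := LinearMap.congr_fun h3 1
    rw [aeval_algHom_apply] at h4
    simpa using h4
  · have : M.map (Ideal.Quotient.mk I) = Matrix.diagonal (fun j ↦ Ideal.Quotient.mk I (d j)) := by
      ext i j
      have := Ideal.Quotient.eq_zero_iff_mem.mpr (N j i).2
      by_cases h : i = j
      · subst h
        simp [M, this]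
      · simp [M, h, this]
    rw [← Matrix.charpoly_map, this, Matrix.charpoly_diagonal, Fintype.prod_option]
    simp [d, mul_comm]

open Polynomial in
/-- In a finite algebra over a henselian pair `(A, I)`, a quotient map to `A ⧸ I` which is cut out
modulo `I` by an idempotent is cut out by an idempotent. -/
theorem HenselianRing.exists_isIdempotentElem {A U : Type*} [CommRing A] [CommRing U]
    [Algebra A U] [Module.Finite A U] (I : Ideal A) [HenselianRing A I] (σ : U →ₐ[A] A ⧸ I) (b : U)
    (hb : σ b = 1) (hker : ∀ x, σ x = 0 → b * x ∈ I.map (algebraMap A U)) :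
    ∃ e : U, IsIdempotentElem e ∧ σ e = 1 ∧ ∀ x, σ x = 0 → e * x ∈ I.map (algebraMap A U) := by
  obtain ⟨p, hp, hpb, n, hpI⟩ := exists_monic_aeval_eq_zero_of_algHom_quotient I σ b hb hker
  have hloc := isLocalHom_of_le_jacobson_bot I (HenselianRing.jac (I := I))
  have hmk (a : A) (ha : a - 1 ∈ I) : Ideal.Quotient.mk I a = 1 := by
    rw [← map_one (Ideal.Quotient.mk I)]; exact Ideal.Quotient.eq.mpr ha
  have heval (a : A) (q : A[X]) (ha : a - 1 ∈ I) :
      Ideal.Quotient.mk I (q.eval a) = (q.map (Ideal.Quotient.mk I)).eval 1 := by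
    rw [← hmk a ha, eval_map, eval₂_at_apply]
  have hder (a : A) (ha : a - 1 ∈ I) : IsUnit (p.derivative.eval a) := by
    refine isUnit_of_map_unit (Ideal.Quotient.mk I) _ ?_
    rw [heval a _ ha, ← derivative_map, hpI]
    simp [derivative_mul]
  obtain ⟨α, hα, hα1⟩ := HenselianRing.is_henselian (I := I) p hp 1
    (by rw [← Ideal.Quotient.eq_zero_iff_mem, heval 1 _ (by simp), hpI]; simp)
    ((hder 1 (by simp)).map _)
  obtain ⟨g, rfl⟩ := dvd_iff_isRoot.mpr hα
  have hgα : IsUnit (g.eval α) := by simpa [derivative_mul] using hder α hα1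
  have hαu : IsUnit α := isUnit_of_map_unit (Ideal.Quotient.mk I) _ (by simp [hmk α hα1])
  obtain ⟨w, hw⟩ := hgα.exists_left_inv
  obtain ⟨β, hβ⟩ := hαu.exists_left_inv
  replace hw := congr(algebraMap A U $hw)
  replace hβ := congr(algebraMap A U $hβ)
  simp only [map_mul, map_one] at hw hβ
  have hbg : (b - algebraMap A U α) * aeval b g = 0 := by simpa using hpb
  obtain ⟨q, hq⟩ := X_sub_C_dvd_sub_C_eval (a := α) (p := g)
  replace hq := congr(aeval b $hq)
  simp only [map_sub, map_mul, aeval_X, aeval_C] at hq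
  have hσ : σ (aeval b g) = σ (algebraMap A U (g.eval α)) := by
    rw [← aeval_algHom_apply, hb, AlgHom.commutes, Ideal.Quotient.algebraMap_eq, heval α g hα1,
      eval_map, ← Ideal.Quotient.algebraMap_eq, aeval_def]
  refine ⟨algebraMap A U w * aeval b g, ?_, ?_, fun x hx ↦ ?_⟩
  · rw [IsIdempotentElem]
    linear_combination algebraMap A U w ^ 2 * aeval b g * hq +
      algebraMap A U w ^ 2 * aeval b q * hbg + algebraMap A U w * aeval b g * hw
  · rw [map_mul, hσ, ← map_mul, hw, map_one]
  · have : algebraMap A U w * aeval b g * x =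
        algebraMap A U β * algebraMap A U w * aeval b g * (b * x) := by
      linear_combination (-algebraMap A U β * algebraMap A U w * x) * hbg
        - algebraMap A U w * aeval b g * x * hβ
    rw [this]
    exact Ideal.mul_mem_left _ _ (hker x hx)

/-- Let `U` be a finite `A`-algebra with a quotient map to `A ⧸ I` which factors through a flat
`A`-algebra `W` and is cut out by an idempotent. Then the quotient map lifts to `A`. -/
theorem exists_algHom_of_isIdempotentElem {A U W : Type*} [CommRing A] [CommRing U] [CommRing W]
    [Algebra A U] [Algebra A W] [Module.Finite A U] [Module.Flat A W] {I : Ideal A}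
    (hI : I ≤ Ideal.jacobson ⊥) (ι : U →ₐ[A] W) (φ : W →ₐ[A] A ⧸ I) {e : U}
    (he : IsIdempotentElem e) (hφe : φ (ι e) = 1)
    (hker : ∀ x, φ (ι x) = 0 → e * x ∈ I.map (algebraMap A U)) :
    ∃ s : U →ₐ[A] A, ∀ x, Ideal.Quotient.mk I (s x) = φ (ι x) := by
  have hgen (u : U) : ∃ a : A, a • e = e * u := by
    suffices h : LinearMap.range (LinearMap.mulLeft A e) ≤ Submodule.span A {e} from
      Submodule.mem_span_singleton.mp (h ⟨u, rfl⟩)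
    refine Submodule.le_of_le_smul_of_le_jacobson_bot (I := I)
      (Module.Finite.fg_top.map _ |> (LinearMap.range_eq_map (LinearMap.mulLeft A e) ▸ ·)) hI ?_
    rintro _ ⟨x, rfl⟩
    obtain ⟨a, ha⟩ := Ideal.Quotient.mk_surjective (φ (ι x))
    have h1 := hker (x - algebraMap A U a) (by simp [← ha])
    have h2 : e * (x - algebraMap A U a) ∈ I • LinearMap.range (LinearMap.mulLeft A e) := by
      rw [LinearMap.range_eq_map, ← Submodule.map_smul'']
      refine ⟨e * (x - algebraMap A U a), ?_, ?_⟩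
      · rw [Ideal.smul_top_eq_map]; exact h1
      · simp [← mul_assoc, he.eq]
    have h3 : LinearMap.mulLeft A e x = a • e + e * (x - algebraMap A U a) := by
      simp [Algebra.smul_def]; ring
    rw [h3]
    exact Submodule.add_mem_sup (Submodule.smul_mem _ _ (Submodule.mem_span_singleton_self e)) h2
  have hinj (a : A) (ha : a • e = 0) : a = 0 := by
    let E := Localization.Away (ι e)
    have : Module.Flat A E := .trans A W E
    let τ : E →ₐ[A] A ⧸ I := IsLocalization.Away.liftAlgHom (f := φ) (ι e) (by simp [hφe])
    have : Module.FaithfullyFlat A E := by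
      refine ⟨fun m hm h ↦ ?_⟩
      have h1 : (1 : E) ∈ m • (⊤ : Submodule A E) := by rw [h]; trivial
      rw [Ideal.smul_top_eq_map] at h1
      have h2 := Ideal.mem_map_of_mem (τ : E →+* A ⧸ I) h1
      rw [map_one, Ideal.map_map, AlgHom.comp_algebraMap] at h2
      have hIm : I ≤ m := hI.trans (sInf_le ⟨bot_le, hm⟩)
      rw [← map_one (algebraMap A (A ⧸ I)), Ideal.Quotient.algebraMap_eq,
        Ideal.mem_quotient_iff_mem hIm] at h2
      exact hm.ne_top ((Ideal.eq_top_iff_one m).mpr h2)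
    have h1 : algebraMap A E a = 0 := by
      have h2 : algebraMap W E (ι (a • e)) = 0 := by simp [ha]
      rw [map_smul, Algebra.smul_def, map_mul, ← IsScalarTower.algebraMap_apply] at h2
      exact ((IsLocalization.Away.algebraMap_isUnit (S := E) (ι e)).mul_left_eq_zero).mp h2
    exact FaithfulSMul.algebraMap_injective A E (by simpa using h1)
  have hcancel {a a' : A} (h : a • e = a' • e) : a = a' :=
    sub_eq_zero.mp (hinj _ (by rw [sub_smul, h, sub_self]))
  choose s hs using hgen
  let s' : U →ₐ[A] A :=
    { toFun := s
      map_one' := hcancel (by rw [hs, mul_one, one_smul])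
      map_zero' := hcancel (by rw [hs, mul_zero, zero_smul])
      map_add' := fun x y ↦ hcancel (by rw [hs, add_smul, hs, hs, mul_add])
      map_mul' := fun x y ↦ hcancel (by
        rw [hs, mul_smul, hs y, ← smul_mul_assoc, hs, mul_assoc])
      commutes' := fun a ↦ hcancel (by rw [hs, Algebra.smul_def, mul_comm]; rfl) }
  refine ⟨s', fun x ↦ ?_⟩
  have := congr(φ (ι $(hs x)))
  change Ideal.Quotient.mk I (s x) = _
  simpa [hφe, Algebra.smul_def] using this

open Polynomial in
/-- Over a henselian pair `(A, I)`, a factorization `X ^ m * (X - 1) ^ m` modulo `I` of a monic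
polynomial lifts to a factorization over `A` into monic polynomials. -/
theorem HenselianRing.exists_monicDegreeEq_mul_eq {A : Type*} [CommRing A] (I : Ideal A)
    [HenselianRing A I] {m : ℕ} (p : MonicDegreeEq A (m + m))
    (hp : p.1.map (Ideal.Quotient.mk I) = X ^ m * (X - 1) ^ m) :
    ∃ G H : MonicDegreeEq A m, G.1 * H.1 = p.1 ∧ G.1.map (Ideal.Quotient.mk I) = X ^ m ∧
      H.1.map (Ideal.Quotient.mk I) = (X - 1) ^ m := by
  let x (S : Type _) [CommRing S] : MonicDegreeEq S m :=
    (MonicDegreeEq.mk (X ^ m : ℤ[X]) (monic_X_pow m) (natDegree_X_pow m)).map (Int.castRingHom S)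
  let y (S : Type _) [CommRing S] : MonicDegreeEq S m :=
    (MonicDegreeEq.mk ((X - C 1) ^ m : ℤ[X]) ((monic_X_sub_C 1).pow m)
      (by rw [natDegree_pow, natDegree_X_sub_C, mul_one])).map (Int.castRingHom S)
  have hx (S : Type _) [CommRing S] : (x S).1 = X ^ m := by simp [x]
  have hy (S : Type _) [CommRing S] : (y S).1 = (X - 1) ^ m := by simp [y]
  let U := UniversalFactorizationRing m m rfl p
  let W := UniversalCoprimeFactorizationRing m m rfl p
  let f₁ : MonicDegreeEq U m := UniversalFactorizationRing.factor₁ m m rfl p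
  let f₂ : MonicDegreeEq U m := UniversalFactorizationRing.factor₂ m m rfl p
  have hf : f₁.1 * f₂.1 = p.1.map (algebraMap A U) :=
    UniversalFactorizationRing.factor₁_mul_factor₂ m m rfl p
  have hcop : IsCoprime (x (A ⧸ I)).1 (y (A ⧸ I)).1 := by
    rw [hx, hy]
    exact IsCoprime.pow ⟨1, -1, by ring⟩
  let φ : W →ₐ[A] A ⧸ I := (UniversalCoprimeFactorizationRing.homEquiv (A ⧸ I) m m rfl p).symm
    ⟨(x _, y _), by rw [hx, hy, ← hp, Ideal.Quotient.algebraMap_eq], hcop⟩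
  let ι : U →ₐ[A] W := IsScalarTower.toAlgHom A U W
  let σ : U →ₐ[A] A ⧸ I := φ.comp ι
  have hσ : (UniversalFactorizationRing.homEquiv (A ⧸ I) m m rfl p σ).1 = (x _, y _) :=
    congr($((UniversalCoprimeFactorizationRing.homEquiv (A ⧸ I) m m rfl p).apply_symm_apply
      ⟨(x _, y _), by rw [hx, hy, ← hp, Ideal.Quotient.algebraMap_eq], hcop⟩).1)
  have hσ₁ : f₁.1.map (σ : U →+* A ⧸ I) = X ^ m := by
    rw [← hx]; exact congr($hσ.1.1)
  have hσ₂ : f₂.1.map (σ : U →+* A ⧸ I) = (X - 1) ^ m := by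
    rw [← hy]; exact congr($hσ.2.1)
  let b : U := ((-1) ^ m) ^ m * f₂.1.coeff 0 ^ m
  have hb : σ b = 1 := by
    have h0 : σ (f₂.1.coeff 0) = (-1) ^ m := by
      have := congr(coeff $hσ₂ 0)
      simpa [coeff_zero_eq_eval_zero] using this
    simp only [b, map_mul, map_pow, map_neg, map_one, h0]
    rw [← mul_pow, ← mul_pow]; simp
  let J : Ideal U := I.map (algebraMap A U)
  have hJ : (Ideal.Quotient.mk J).comp (algebraMap A U) =
      (Ideal.quotientMap J (algebraMap A U) Ideal.le_comap_map).comp (Ideal.Quotient.mk I) := by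
    ext; simp
  obtain ⟨h₁, h₂⟩ := C_coeff_zero_pow_mul_sub_eq_zero (m := m)
    (g := f₁.1.map (Ideal.Quotient.mk J)) (h := f₂.1.map (Ideal.Quotient.mk J)) (q := (X - 1) ^ m)
    (fun i hi ↦ by
      rw [← MonicDegreeEq.map_coe, MonicDegreeEq.coeff_of_ge _ _ hi, coeff_X_pow])
    (by
      rw [← Polynomial.map_mul, hf, Polynomial.map_map, hJ, ← Polynomial.map_map, hp]
      simp)
  have hker (u : U) (hu : σ u = 0) : b * u ∈ J := by
    let K : Ideal U := Submodule.comap (LinearMap.mulLeft U b) J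
    have hIK : ∀ a ∈ I, Algebra.ofId A (U ⧸ K) a = 0 := fun a ha ↦
      Ideal.Quotient.eq_zero_iff_mem.mpr
        (J.mul_mem_left b (Ideal.mem_map_of_mem _ ha))
    let θ : A ⧸ I →ₐ[A] U ⧸ K := Ideal.Quotient.liftₐ I (Algebra.ofId A (U ⧸ K)) hIK
    have hK (f g : U[X]) (h : C ((f₂.1.map (Ideal.Quotient.mk J)).coeff 0 ^ m) *
        (f.map (Ideal.Quotient.mk J) - g.map (Ideal.Quotient.mk J)) = 0) :
        f.map (Ideal.Quotient.mk K) = g.map (Ideal.Quotient.mk K) := by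
      ext i
      rw [coeff_map, coeff_map, Ideal.Quotient.eq]
      change b * _ ∈ J
      have := congr(coeff $h i)
      rw [coeff_C_mul, coeff_sub, coeff_map, coeff_map, coeff_map, ← map_pow, ← map_sub, ← map_mul,
        coeff_zero, Ideal.Quotient.eq_zero_iff_mem] at this
      rw [mul_assoc]
      exact J.mul_mem_left _ this
    have heq : Ideal.Quotient.mkₐ A K = θ.comp σ := by
      apply (UniversalFactorizationRing.homEquiv (U ⧸ K) m m rfl p).injective
      refine Subtype.ext (Prod.ext (Subtype.ext ?_) (Subtype.ext ?_))
      · change f₁.1.map (Ideal.Quotient.mk K) =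
          f₁.1.map ((θ : A ⧸ I →+* U ⧸ K).comp (σ : U →+* A ⧸ I))
        rw [← Polynomial.map_map, hσ₁, hK _ (X ^ m) (by simpa using h₁)]
        simp
      · change f₂.1.map (Ideal.Quotient.mk K) =
          f₂.1.map ((θ : A ⧸ I →+* U ⧸ K).comp (σ : U →+* A ⧸ I))
        rw [← Polynomial.map_map, hσ₂, hK _ ((X - 1) ^ m) (by simpa using h₂)]
        simp
    have := congr($heq u)
    rw [AlgHom.comp_apply, hu, map_zero] at this
    exact (Ideal.Quotient.eq_zero_iff_mem (I := K)).mp this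
  obtain ⟨e, he, hσe, heker⟩ := exists_isIdempotentElem I σ b hb hker
  have : Module.Flat A W := Algebra.Smooth.flat A W
  obtain ⟨s, hs⟩ := exists_algHom_of_isIdempotentElem (jac (I := I)) ι φ he hσe heker
  have hs' : (Ideal.Quotient.mk I).comp (s : U →+* A) = σ := RingHom.ext hs
  refine ⟨f₁.map s, f₂.map s, ?_, ?_, ?_⟩
  · rw [MonicDegreeEq.map_coe, MonicDegreeEq.map_coe, ← Polynomial.map_mul, hf, Polynomial.map_map]
    simp
  · rw [MonicDegreeEq.map_coe, Polynomial.map_map, ← hσ₁]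
    exact congr(f₁.1.map $hs')
  · rw [MonicDegreeEq.map_coe, Polynomial.map_map, ← hσ₂]
    exact congr(f₂.1.map $hs')

open Polynomial in
/-- An element of a finite `A`-algebra which is idempotent modulo `I` is annihilated by a monic
polynomial lifting `X ^ m * (X - 1) ^ m`. -/
theorem exists_monicDegreeEq_aeval_eq_zero_of_sq_sub_mem {A U : Type*} [CommRing A] [CommRing U]
    [Algebra A U] [Module.Finite A U] (I : Ideal A) (c : U)
    (hc : c ^ 2 - c ∈ I.map (algebraMap A U)) :
    ∃ (m : ℕ) (p : MonicDegreeEq A (m + m)), m ≠ 0 ∧ aeval c p.1 = 0 ∧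
      p.1.map (Ideal.Quotient.mk I) = X ^ m * (X - 1) ^ m := by
  cases subsingleton_or_nontrivial A
  · have := (algebraMap A U).codomain_trivial
    exact ⟨1, ⟨0, Subsingleton.elim _ _, fun _ _ ↦ coeff_zero _⟩, one_ne_zero,
      Subsingleton.elim _ _, Subsingleton.elim _ _⟩
  obtain ⟨q, hq, -, hqI, hqc⟩ :=
    LinearMap.exists_monic_and_natDegree_eq_and_coeff_mem_pow_and_aeval_eq_zero
      (R := A) (Algebra.lmul A U (c ^ 2 - c)) I (by
        rintro _ ⟨x, rfl⟩
        rw [Ideal.smul_top_eq_map]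
        exact Ideal.mul_mem_right _ _ hc)
  have hqX : q.map (Ideal.Quotient.mk I) = X ^ q.natDegree := by
    ext k
    rw [coeff_map, coeff_X_pow]
    rcases lt_trichotomy k q.natDegree with hk | rfl | hk
    · rw [if_neg hk.ne, Ideal.Quotient.eq_zero_iff_mem]
      exact Ideal.pow_le_self (Nat.sub_ne_zero_of_lt hk) (hqI k)
    · rw [if_pos rfl, hq.coeff_natDegree, map_one]
    · rw [if_neg hk.ne', coeff_eq_zero_of_natDegree_lt hk, map_zero]
  have hr : (X ^ 2 - X : A[X]).natDegree = 2 := by compute_degree!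
  have hr' : (X ^ 2 - X : A[X]).Monic := by monicity!
  refine ⟨q.natDegree + 1, .mk ((q * X).comp (X ^ 2 - X))
    ((hq.mul monic_X).comp hr' (by simp [hr])) ?_, by simp, ?_, ?_⟩
  · rw [natDegree_comp_eq_of_mul_ne_zero (by simp [(hq.mul monic_X).leadingCoeff,
      hr'.leadingCoeff]), hr, hq.natDegree_mul monic_X, natDegree_X]; ring
  · have h := LinearMap.congr_fun hqc 1
    rw [aeval_algHom_apply] at h
    have h' : aeval (c ^ 2 - c) q = 0 := by simpa using h
    simp [aeval_comp, h']
  · rw [MonicDegreeEq.mk_coe, map_comp, Polynomial.map_mul, hqX, map_X, ← pow_succ, X_pow_comp,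
      ← mul_pow]
    simp only [Polynomial.map_sub, Polynomial.map_pow, map_X]
    ring

open Polynomial in
/-- Idempotents lift along `U → U ⧸ I U` for a finite algebra `U` over a henselian pair `(A, I)`. -/
theorem HenselianRing.exists_isIdempotentElem_sub_mem {A U : Type*} [CommRing A] [CommRing U]
    [Algebra A U] [Module.Finite A U] (I : Ideal A) [HenselianRing A I] (c : U)
    (hc : c ^ 2 - c ∈ I.map (algebraMap A U)) :
    ∃ e : U, IsIdempotentElem e ∧ e - c ∈ I.map (algebraMap A U) := by
  obtain ⟨m, p, hm, hpc, hp⟩ := exists_monicDegreeEq_aeval_eq_zero_of_sq_sub_mem I c hc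
  obtain ⟨G, H, hGH, hG, hH⟩ := exists_monicDegreeEq_mul_eq I p hp
  have hcop : IsCoprime G.1 H.1 := by
    have hloc := isLocalHom_of_le_jacobson_bot I (jac (I := I))
    rw [← isUnit_resultant_iff_isCoprime G.monic]
    refine isUnit_of_map_unit (Ideal.Quotient.mk I) _ ?_
    cases subsingleton_or_nontrivial (A ⧸ I)
    · exact isUnit_of_subsingleton _
    rw [← resultant_map_map, ← G.monic.natDegree_map (Ideal.Quotient.mk I),
      ← H.monic.natDegree_map (Ideal.Quotient.mk I),
      isUnit_resultant_iff_isCoprime (G.monic.map _), hG, hH]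
    exact IsCoprime.pow ⟨1, -1, by ring⟩
  obtain ⟨u, v, huv⟩ := hcop
  have h1 : aeval c u * aeval c G.1 + aeval c v * aeval c H.1 = 1 := by
    rw [← map_mul, ← map_mul, ← map_add, huv, map_one]
  have h2 : aeval c G.1 * aeval c H.1 = 0 := by rw [← map_mul, hGH, hpc]
  refine ⟨aeval c u * aeval c G.1, ?_, ?_⟩
  · rw [IsIdempotentElem]
    linear_combination aeval c u * aeval c G.1 * h1 - aeval c u * aeval c v * h2
  · obtain ⟨r, hr⟩ : X * (X - 1) ∣ (u * G.1 - X).map (Ideal.Quotient.mk I) := by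
      refine IsCoprime.mul_dvd ⟨1, -1, by ring⟩ ?_ ?_
      · rw [Polynomial.map_sub, Polynomial.map_mul, hG, map_X]
        exact dvd_sub ((dvd_pow_self X hm).mul_left _) dvd_rfl
      · have h3 := congr(($huv).map (Ideal.Quotient.mk I))
        simp only [Polynomial.map_add, Polynomial.map_mul, hG, hH, Polynomial.map_one] at h3
        rw [Polynomial.map_sub, Polynomial.map_mul, hG, map_X]
        have h4 : u.map (Ideal.Quotient.mk I) * X ^ m - X =
            -(X - 1) - v.map (Ideal.Quotient.mk I) * (X - 1) ^ m := by
          linear_combination h3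
        rw [h4]
        exact dvd_sub dvd_rfl.neg_right ((dvd_pow_self _ hm).mul_left _)
    obtain ⟨r, rfl⟩ := map_surjective _ Ideal.Quotient.mk_surjective r
    have h3 : u * G.1 - X - X * (X - 1) * r ∈ I.map C := by
      rw [← Ideal.mk_ker (I := I), ← ker_mapRingHom, RingHom.mem_ker, map_sub, coe_mapRingHom, hr]
      simp
    have h4 := Ideal.mem_map_of_mem ((aeval c : A[X] →ₐ[A] U) : A[X] →+* U) h3
    rw [Ideal.map_map, ← algebraMap_eq, AlgHom.comp_algebraMap, RingHom.coe_coe] at h4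
    convert add_mem h4 (Ideal.mul_mem_right (aeval c r) _ hc) using 1
    simp only [map_sub, map_mul, aeval_X, map_one]
    ring

/-- Along an integral map, ideals in the Jacobson radical extend to such ideals. -/
theorem Ideal.map_le_jacobson_bot_of_isIntegral {A B : Type*} [CommRing A] [CommRing B]
    [Algebra A B] [Algebra.IsIntegral A B] {I : Ideal A} (hI : I ≤ jacobson ⊥) :
    I.map (algebraMap A B) ≤ jacobson ⊥ := by
  refine le_sInf fun M ⟨_, hM⟩ ↦ map_le_iff_le_comap.mpr (hI.trans (sInf_le ⟨bot_le, ?_⟩))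
  exact isMaximal_comap_of_isIntegral_of_isMaximal M

/-- Let `A` be a commutative ring, `I` an ideal (and `B = A/I`).  If `(A, I)` is a henselian
pair and `A → A'` is a finite ring homomorphism, then `(A', IA')` is a henselian pair. -/
theorem stmt15 (A : Type*) [CommRing A] (I : Ideal A) [HenselianRing A I]
    (A' : Type*) [CommRing A'] [Algebra A A'] [Module.Finite A A'] :
    HenselianRing A' (I.map (algebraMap A A')) := by
  have hJ := Ideal.map_le_jacobson_bot_of_isIntegral (B := A') (HenselianRing.jac (I := I))
  refine ⟨hJ, fun f hf a₀ ha₀ hu ↦ ?_⟩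
  set J := I.map (algebraMap A A')
  have hloc := isLocalHom_of_le_jacobson_bot J hJ
  have := hf.finite_adjoinRoot
  have := hf.free_adjoinRoot
  have : Module.Finite A (AdjoinRoot f) := .trans A' _
  let σ : AdjoinRoot f →ₐ[A'] A' ⧸ J := AdjoinRoot.liftAlgHom f (Algebra.ofId A' _)
    (Ideal.Quotient.mk J a₀) (by
      change f.eval₂ (Ideal.Quotient.mk J) _ = 0
      rw [Polynomial.eval₂_at_apply]
      exact Ideal.Quotient.eq_zero_iff_mem.mpr ha₀)
  have hσ (x : AdjoinRoot f) (hx : x ∈ J.map (algebraMap A' (AdjoinRoot f))) : σ x = 0 := by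
    suffices h : J.map (algebraMap A' (AdjoinRoot f)) ≤ RingHom.ker σ from h hx
    refine Ideal.map_le_iff_le_comap.mpr fun a ha ↦ ?_
    exact (σ.commutes a).trans (Ideal.Quotient.eq_zero_iff_mem.mpr ha)
  have hσ_aeval (g : Polynomial A') :
      σ (Polynomial.aeval (AdjoinRoot.root f) g) = Ideal.Quotient.mk J (g.eval a₀) := by
    rw [← Polynomial.aeval_algHom_apply, AdjoinRoot.liftAlgHom_root,
      ← Ideal.Quotient.algebraMap_eq, Polynomial.aeval_algebraMap_apply,
      Polynomial.coe_aeval_eq_eval]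
  have hroot : Polynomial.aeval (AdjoinRoot.root f) f = 0 := by
    rw [AdjoinRoot.aeval_eq, AdjoinRoot.mk_self]
  obtain ⟨w, hw⟩ := (isUnit_of_map_unit (Ideal.Quotient.mk J) _ hu).exists_left_inv
  obtain ⟨q, hq⟩ := Polynomial.X_sub_C_dvd_sub_C_eval (a := a₀) (p := f)
  have hqa : q.eval a₀ = f.derivative.eval a₀ := by
    have := congr(($hq).derivative.eval a₀)
    simpa [Polynomial.derivative_mul] using this.symm
  let c : AdjoinRoot f := algebraMap A' _ w * Polynomial.aeval (AdjoinRoot.root f) q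
  have hσc : σ c = 1 := by
    rw [map_mul, hσ_aeval, AlgHom.commutes, Ideal.Quotient.algebraMap_eq, ← map_mul, hqa, hw,
      map_one]
  have hc : c * (AdjoinRoot.root f - algebraMap A' _ a₀) ∈
      J.map (algebraMap A' (AdjoinRoot f)) := by
    have h := congr(Polynomial.aeval (AdjoinRoot.root f) $hq)
    simp only [map_sub, map_mul, Polynomial.aeval_X, Polynomial.aeval_C, hroot] at h
    have h' : c * (AdjoinRoot.root f - algebraMap A' _ a₀) =
        -algebraMap A' _ w * algebraMap A' _ (f.eval a₀) := by
      linear_combination -algebraMap A' _ w * h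
    rw [h']
    exact Ideal.mul_mem_left _ _ (Ideal.mem_map_of_mem _ ha₀)
  have hker (x : AdjoinRoot f) (hx : σ x = 0) : c * x ∈ J.map (algebraMap A' (AdjoinRoot f)) := by
    obtain ⟨g, rfl⟩ := AdjoinRoot.mk_surjective x
    rw [← AdjoinRoot.aeval_eq] at hx ⊢
    rw [hσ_aeval, Ideal.Quotient.eq_zero_iff_mem] at hx
    obtain ⟨r, hr⟩ := Polynomial.X_sub_C_dvd_sub_C_eval (a := a₀) (p := g)
    have h := congr(Polynomial.aeval (AdjoinRoot.root f) $hr)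
    simp only [map_sub, map_mul, Polynomial.aeval_X, Polynomial.aeval_C] at h
    have h' : c * Polynomial.aeval (AdjoinRoot.root f) g =
        c * algebraMap A' _ (g.eval a₀) + c * (AdjoinRoot.root f - algebraMap A' _ a₀) *
          Polynomial.aeval (AdjoinRoot.root f) r := by
      linear_combination c * h
    rw [h']
    exact add_mem (Ideal.mul_mem_left _ _ (Ideal.mem_map_of_mem _ hx)) (Ideal.mul_mem_right _ _ hc)
  have hcc : c ^ 2 - c ∈ I.map (algebraMap A (AdjoinRoot f)) := by
    rw [IsScalarTower.algebraMap_eq A A' (AdjoinRoot f), ← Ideal.map_map]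
    simpa [mul_sub, pow_two] using hker (c - 1) (by simp [hσc])
  obtain ⟨e, he, hec⟩ := HenselianRing.exists_isIdempotentElem_sub_mem I c hcc
  rw [IsScalarTower.algebraMap_eq A A' (AdjoinRoot f), ← Ideal.map_map] at hec
  obtain ⟨s, hs⟩ := exists_algHom_of_isIdempotentElem hJ (AlgHom.id A' _) σ he
    (by simpa [hσc, sub_eq_zero] using hσ _ hec) fun x hx ↦ by
      have h := add_mem (hker x hx) (Ideal.mul_mem_right x _ hec)
      rwa [← add_mul, add_sub_cancel] at h
  refine ⟨s (AdjoinRoot.root f), ?_, ?_⟩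
  · rw [Polynomial.IsRoot, ← Polynomial.coe_aeval_eq_eval, Polynomial.aeval_algHom_apply, hroot,
      map_zero]
  · rw [← Ideal.Quotient.eq, hs, AlgHom.id_apply]
    exact AdjoinRoot.liftAlgHom_root ..
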